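/- (Monotonicity of jigsaw percolation.) Let V be a finite vertex set and let E_people ⊆ E'_people and E_puzzle ⊆ E'_puzzle be edge sets on V. If the people graph (V, E_people) solves the puzzle (V, E_puzzle), then the people graph (V, E'_people) solves the puzzle (V, E'_puzzle). -/

import Mathlib

open MeasureTheory Filter Topology

namespace Jigsaw

variable {V : Type*}

/-- Two vertex sets are adjacent in the graph `G` if some element of one is
`G`-adjacent to some element of the other. -/
def SetAdj (G : SimpleGraph V) (U W : Set V) : Prop :=
  ∃ u ∈ U, ∃ w ∈ W, G.Adj u w

/-- The auxiliary graph on the blocks of a collection `C`, joining pairs of distinct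
blocks that are both people-adjacent and puzzle-adjacent. -/
def clusterGraph (Gpe Gpu : SimpleGraph V) (C : Set (Set V)) : SimpleGraph C where
  Adj U W := U ≠ W ∧ SetAdj Gpe U.1 W.1 ∧ SetAdj Gpu U.1 W.1
  symm.symm := by
    rintro U W ⟨hne, ⟨u, hu, w, hw, ha⟩, ⟨u', hu', w', hw', ha'⟩⟩
    exact ⟨hne.symm, ⟨w, hw, u, hu, ha.symm⟩, ⟨w', hw', u', hu', ha'.symm⟩⟩
  loopless.irrefl := fun U h => h.1 rfl

/-- One step of jigsaw percolation: within each connected component of the cluster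
graph, merge all blocks of that component into a single block. -/
def step (Gpe Gpu : SimpleGraph V) (C : Set (Set V)) : Set (Set V) :=
  { S | ∃ cc : (clusterGraph Gpe Gpu C).ConnectedComponent,
      S = ⋃₀ { U : Set V | ∃ h : U ∈ C,
        (clusterGraph Gpe Gpu C).connectedComponentMk ⟨U, h⟩ = cc } }

/-- The partition `C_i` after `i` steps of jigsaw percolation, starting from
singletons. -/
def clusters (Gpe Gpu : SimpleGraph V) : ℕ → Set (Set V)
  | 0 => { S | ∃ v : V, S = {v} }
  | i + 1 => step Gpe Gpu (clusters Gpe Gpu i)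

/-- The people graph `Gpe` solves the puzzle `Gpu`: the process reaches the
partition `{V}`. -/
def Solves (Gpe Gpu : SimpleGraph V) : Prop :=
  ∃ i, clusters Gpe Gpu i = {Set.univ}

/-- `U ⊆ V` is internally solved: jigsaw percolation on `U` with both graphs induced
on `U` ends with the single block `U`. -/
def InternallySolved (Gpe Gpu : SimpleGraph V) (U : Set V) : Prop :=
  Solves (SimpleGraph.induce U Gpe) (SimpleGraph.induce U Gpu)

/-- The graph determined by the Boolean edge indicators `ω`. -/
def graphOf (ω : Sym2 V → Bool) : SimpleGraph V where
  Adj u v := u ≠ v ∧ ω s(u, v) = true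
  symm.symm := by
    intro u v h
    exact ⟨h.1.symm, by rw [Sym2.eq_swap]; exact h.2⟩
  loopless.irrefl := fun u h => h.1 rfl

/-- The Erdős–Rényi measure: each possible edge appears independently with
probability `p` (the parameter is clamped to `[0,1]`, so for `p ∈ [0,1]` each edge
appears with probability exactly `p`). -/
noncomputable def erMeasure (V : Type*) [Fintype V] [DecidableEq V] (p : ℝ) :
    Measure (Sym2 V → Bool) :=
  Measure.pi fun _ : Sym2 V =>
    (PMF.bernoulli (min (Real.toNNReal p) 1) (min_le_right _ _)).toMeasure

/-- The ring (`n`-cycle) puzzle graph on `Fin n`. -/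
def ringGraph (n : ℕ) : SimpleGraph (Fin n) where
  Adj u v := u ≠ v ∧ (((u : ℕ) + 1) % n = (v : ℕ) ∨ ((v : ℕ) + 1) % n = (u : ℕ))
  symm.symm := fun u v h => ⟨h.1.symm, h.2.symm⟩
  loopless.irrefl := fun u h => h.1 rfl

/-- The ring (`n`-cycle) puzzle graph on `ZMod n`. -/
def zmodRing (n : ℕ) : SimpleGraph (ZMod n) where
  Adj u v := u ≠ v ∧ (u + 1 = v ∨ v + 1 = u)
  symm.symm := fun u v h => ⟨h.1.symm, h.2.symm⟩
  loopless.irrefl := fun u h => h.1 rfl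

/-- The interval of residues `[a, b]` in `ZMod n` is `x`-good with respect to the
people graph `Gpe` if some `u ∈ [a, b]` has no people-edge to any vertex of
`[a - x, b + x]`. -/
def xGood {n : ℕ} (Gpe : SimpleGraph (ZMod n)) (x : ℕ) (a b : ℤ) : Prop :=
  ∃ u : ℤ, a ≤ u ∧ u ≤ b ∧
    ∀ w : ℤ, a - x ≤ w → w ≤ b + x → ¬ Gpe.Adj (u : ZMod n) (w : ZMod n)

/-- The star puzzle graph on `Fin n` with all edges to the last vertex. -/
def starGraph (n : ℕ) : SimpleGraph (Fin n) where
  Adj u v := u ≠ v ∧ ((u : ℕ) = n - 1 ∨ (v : ℕ) = n - 1)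
  symm.symm := fun u v h => ⟨h.1.symm, h.2.symm⟩
  loopless.irrefl := fun u h => h.1 rfl

end Jigsaw


namespace Jigsaw

/-- Blocks of the process are nonempty, and two blocks that meet are equal. -/
theorem clusters_partition {V : Type*} (G H : SimpleGraph V) (i : ℕ) :
    (∀ U ∈ clusters G H i, U.Nonempty) ∧
    (∀ U ∈ clusters G H i, ∀ W ∈ clusters G H i, ∀ x, x ∈ U → x ∈ W → U = W) := by
  induction i with
  | zero =>
    constructor
    · rintro U ⟨v, rfl⟩
      exact ⟨v, rfl⟩
    · rintro U ⟨v, rfl⟩ W ⟨w, rfl⟩ x hx hy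
      have h1 : x = v := hx
      have h2 : x = w := hy
      rw [← h1, ← h2]
  | succ i ih =>
    obtain ⟨ih1, ih2⟩ := ih
    constructor
    · rintro U ⟨cc, rfl⟩
      induction cc using SimpleGraph.ConnectedComponent.ind with
      | h A =>
        obtain ⟨x, hx⟩ := ih1 A.1 A.2
        exact ⟨x, A.1, ⟨A.2, rfl⟩, hx⟩
    · rintro U ⟨cc, rfl⟩ W ⟨dd, rfl⟩ x ⟨A, ⟨hA, rfl⟩, hxA⟩ ⟨B, ⟨hB, rfl⟩, hxB⟩
      have hAB : A = B := ih2 A hA B hB x hxA hxB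
      subst hAB
      rfl

/-- One step preserves refinement. -/
theorem step_refines {V : Type*} {G G' H H' : SimpleGraph V} (hG : G ≤ G') (hH : H ≤ H')
    {C C' : Set (Set V)} (hC : ∀ U ∈ C, ∃ U' ∈ C', U ⊆ U') :
    ∀ S ∈ step G H C, ∃ S' ∈ step G' H' C', S ⊆ S' := by
  choose f hf hsub using hC
  let g : C → C' := fun U => ⟨f U.1 U.2, hf U.1 U.2⟩
  have hreach : ∀ A B : C, (clusterGraph G H C).Reachable A B →
      (clusterGraph G' H' C').Reachable (g A) (g B) := by
    rintro A B ⟨p⟩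
    induction p with
    | nil => exact SimpleGraph.Reachable.refl _
    | @cons A B D hAB p ih =>
      refine SimpleGraph.Reachable.trans ?_ ih
      by_cases he : g A = g B
      · rw [he]
      · obtain ⟨-, ⟨u, hu, w, hw, ha⟩, ⟨u', hu', w', hw', ha'⟩⟩ := hAB
        refine SimpleGraph.Adj.reachable ⟨he, ⟨u, ?_, w, ?_, hG ha⟩, ⟨u', ?_, w', ?_, hH ha'⟩⟩
        · exact hsub _ A.2 hu
        · exact hsub _ B.2 hw
        · exact hsub _ A.2 hu'
        · exact hsub _ B.2 hw'
  rintro S ⟨cc, rfl⟩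
  induction cc using SimpleGraph.ConnectedComponent.ind with
  | h A =>
    refine ⟨_, ⟨(clusterGraph G' H' C').connectedComponentMk (g A), rfl⟩, ?_⟩
    rintro x ⟨B, ⟨hB, hBA⟩, hx⟩
    refine ⟨f B hB, ⟨hf B hB, ?_⟩, hsub B hB hx⟩
    exact SimpleGraph.ConnectedComponent.sound
      (hreach ⟨B, hB⟩ A (SimpleGraph.ConnectedComponent.exact hBA))

theorem clusters_refines {V : Type*} {G G' H H' : SimpleGraph V} (hG : G ≤ G') (hH : H ≤ H')
    (i : ℕ) : ∀ U ∈ clusters G H i, ∃ U' ∈ clusters G' H' i, U ⊆ U' := by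
  induction i with
  | zero => exact fun U hU => ⟨U, hU, subset_rfl⟩
  | succ i ih => exact step_refines hG hH ih

end Jigsaw

/-- Monotonicity of jigsaw percolation: adding edges to the people
graph or the puzzle graph cannot destroy solvability. -/
theorem jigsaw_solves_mono {V : Type*} [Fintype V]
    {Gpe Gpe' Gpu Gpu' : SimpleGraph V} (hpe : Gpe ≤ Gpe') (hpu : Gpu ≤ Gpu')
    (h : Jigsaw.Solves Gpe Gpu) : Jigsaw.Solves Gpe' Gpu' := by
  obtain ⟨i, hi⟩ := h
  refine ⟨i, ?_⟩
  obtain ⟨U, hU, hsub⟩ := Jigsaw.clusters_refines hpe hpu i Set.univ (by rw [hi]; rfl)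
  have hUu : U = Set.univ := Set.univ_subset_iff.mp hsub
  subst hUu
  obtain ⟨h1, h2⟩ := Jigsaw.clusters_partition Gpe' Gpu' i
  ext W
  constructor
  · intro hW
    obtain ⟨x, hx⟩ := h1 W hW
    exact h2 W hW _ hU x hx trivial
  · intro hW
    have hWu : W = Set.univ := hW
    rw [hWu]
    exact hU
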